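/- arXiv:2501.18024 — 2 statements merged into one kernel-verified Lean document; each statement's English description precedes it below -/
import Mathlib

section
/- Let L and N be positive integers, let ε ∈ {−1, 1}, and let Λ : {1, …, L} → ℂ be a function satisfying the functional equation Λ(j) = ε·Λ(L+1−j) for all 1 ≤ j ≤ L. Define R : ℂ → ℂ by R(z) := i^L·N^{−L/2}·Σ_{n=0}^{L−1} binom(L−1, n)·(i·√N·z)^n·Λ(L−n). Then for every nonzero complex number z one has R(−1/(N·z)) = ε·i^{3(L−1)}·z^{1−L}·N^{(1−L)/2}·R(z). -/
open Complex

/-- A binomial sum whose coefficients satisfy a reflection formula is self-reciprocal up to `c`. -/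
lemma sum_choose_mul_inv_pow_of_reflect {K : Type*} [Field K] (m : ℕ) (c w : K) (hw : w ≠ 0)
    (a : ℕ → K) (ha : ∀ j, 1 ≤ j → j ≤ m + 1 → a j = c * a (m + 1 + 1 - j)) :
    ∑ n ∈ Finset.range (m + 1), (m.choose n : K) * w⁻¹ ^ n * a (m + 1 - n) =
      c * w⁻¹ ^ m * ∑ n ∈ Finset.range (m + 1), (m.choose n : K) * w ^ n * a (m + 1 - n) := by
  rw [← Finset.sum_range_reflect, Finset.mul_sum]
  refine Finset.sum_congr rfl fun n hn => ?_
  have hnm : n ≤ m := Nat.lt_succ_iff.mp (Finset.mem_range.mp hn)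
  have hpow : w⁻¹ ^ m * w ^ n = w⁻¹ ^ (m - n) := by
    rw [← Nat.sub_add_cancel hnm, pow_add, mul_assoc, ← mul_pow, inv_mul_cancel₀ hw, one_pow,
      mul_one, Nat.sub_add_cancel hnm]
  rw [show m + 1 - 1 - n = m - n by omega, show m + 1 - (m - n) = n + 1 by omega,
    Nat.choose_symm hnm, ha (n + 1) (by omega) (by omega),
    show m + 1 + 1 - (n + 1) = m + 1 - n by omega, ← hpow]
  ring

/-- **Lemma 2.3 in abstract form.**  Let `L, N ≥ 1`, `ε = ±1`, and let
`Λ : ℕ → ℂ` satisfy `Λ(j) = ε Λ(L+1-j)` for `1 ≤ j ≤ L`.  Then the period polynomial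
`R(z) = i^L N^{-L/2} Σ_{n=0}^{L-1} binom(L-1,n) (i√N z)^n Λ(L-n)`
satisfies `R(-1/(Nz)) = ε i^{3(L-1)} z^{1-L} N^{(1-L)/2} R(z)` for all `z ≠ 0`. -/
theorem period_polynomial_functional_equation
    (L N : ℕ) (hL : 0 < L) (hN : 0 < N)
    (ε : ℝ) (hε : ε = 1 ∨ ε = -1)
    (Λ : ℕ → ℂ) (hΛ : ∀ j : ℕ, 1 ≤ j → j ≤ L → Λ j = (ε : ℂ) * Λ (L + 1 - j))
    (R : ℂ → ℂ)
    (hR : ∀ z : ℂ, R z = I ^ L * ((Real.sqrt N : ℂ)) ^ (-(L : ℤ)) *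
        ∑ n ∈ Finset.range L,
          (Nat.choose (L - 1) n : ℂ) * (I * (Real.sqrt N : ℂ) * z) ^ n * Λ (L - n)) :
    ∀ z : ℂ, z ≠ 0 →
      R (-1 / ((N : ℂ) * z)) =
        (ε : ℂ) * I ^ (3 * (L - 1)) * z ^ ((1 : ℤ) - L) *
          ((Real.sqrt N : ℂ)) ^ ((1 : ℤ) - L) * R z := by
  intro z hz
  obtain ⟨m, rfl⟩ := Nat.exists_eq_add_of_lt hL
  simp only [zero_add, Nat.add_sub_cancel] at *
  have hs : (Real.sqrt N : ℂ) ≠ 0 := by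
    exact_mod_cast (Real.sqrt_pos.mpr (Nat.cast_pos.mpr hN)).ne'
  have hsq : (N : ℂ) = (Real.sqrt N : ℂ) * (Real.sqrt N : ℂ) := by
    exact_mod_cast (Real.mul_self_sqrt (Nat.cast_nonneg N)).symm
  have hw : I * (Real.sqrt N : ℂ) * z ≠ 0 := mul_ne_zero (mul_ne_zero I_ne_zero hs) hz
  have harg : I * (Real.sqrt N : ℂ) * (-1 / ((N : ℂ) * z)) = (I * (Real.sqrt N : ℂ) * z)⁻¹ := by
    rw [hsq, mul_inv, mul_inv, inv_I]
    field_simp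
  have hexp : (1 : ℤ) - (m + 1 : ℕ) = -(m : ℤ) := by push_cast; ring
  have hI : I ^ (3 * m) = I⁻¹ ^ m := by rw [pow_mul, I_pow_three, inv_I]
  rw [hR, hR, harg, sum_choose_mul_inv_pow_of_reflect m (ε : ℂ) _ hw Λ hΛ, hexp, hI,
    zpow_neg z, zpow_neg _ (m : ℤ), zpow_natCast, zpow_natCast, mul_inv, mul_inv, mul_pow, mul_pow,
    inv_pow z, inv_pow (Real.sqrt N : ℂ)]
  ring
end

section
/- Let m be a positive integer and let s be a real number with s ≥ 5/2. Then ζ(s)^m − 1 < (13/9)·2^{m−s}, where ζ is the Riemann zeta function. -/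
open Complex

theorem ofReal_tsum_one_div_nat_rpow_eq_riemannZeta {s : ℝ} (hs : 1 < s) :
    ((∑' n : ℕ, 1 / (n : ℝ) ^ s : ℝ) : ℂ) = riemannZeta (s : ℂ) := by
  rw [zeta_eq_tsum_one_div_nat_cpow (by simpa using hs), Complex.ofReal_tsum]
  refine tsum_congr fun n => ?_
  push_cast
  rw [Complex.ofReal_cpow (Nat.cast_nonneg n)]
  simp

theorem two_div_rpow_le {n s : ℝ} (hn : 3 ≤ n) (hs : 5 / 2 ≤ s) :
    (2 / n) ^ s ≤ 82 / 100 * (2 / n) ^ 2 := by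
  have hpos : 0 < 2 / n := by positivity
  have hle : 2 / n ≤ 2 / 3 := by gcongr
  have hsqrt : √(2 / n) ≤ 82 / 100 :=
    Real.sqrt_le_iff.mpr ⟨by norm_num, by linarith⟩
  calc (2 / n) ^ s ≤ (2 / n) ^ (5 / 2 : ℝ) :=
        Real.rpow_le_rpow_of_exponent_ge hpos (by linarith) hs
    _ = √(2 / n) * (2 / n) ^ 2 := by
        rw [Real.sqrt_eq_rpow, ← Real.rpow_natCast, ← Real.rpow_add hpos]
        norm_num
    _ ≤ 82 / 100 * (2 / n) ^ 2 := by gcongr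

theorem one_div_nat_add_three_rpow_le (n : ℕ) {s : ℝ} (hs : 5 / 2 ≤ s) :
    1 / ((n + 3 : ℕ) : ℝ) ^ s
      ≤ 328 / 100 * (2 : ℝ) ^ (-s) * (1 / ((n + 3 : ℕ) : ℝ) ^ 2) := by
  have hn : (3 : ℝ) ≤ ((n + 3 : ℕ) : ℝ) := by simp
  have h := two_div_rpow_le hn hs
  rw [Real.div_rpow (by norm_num) (by positivity)] at h
  have h2 : (0 : ℝ) < 2 ^ s := by positivity
  rw [Real.rpow_neg (by norm_num)]
  calc 1 / ((n + 3 : ℕ) : ℝ) ^ s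
      = ((2 : ℝ) ^ s)⁻¹ * (2 ^ s / ((n + 3 : ℕ) : ℝ) ^ s) := by field_simp
    _ ≤ ((2 : ℝ) ^ s)⁻¹ * (82 / 100 * (2 / ((n + 3 : ℕ) : ℝ)) ^ 2) := by gcongr
    _ = _ := by ring

theorem tsum_one_div_nat_rpow_le {s : ℝ} (hs : 5 / 2 ≤ s) :
    ∑' n : ℕ, 1 / (n : ℝ) ^ s ≤ 1 + 23 / 10 * (2 : ℝ) ^ (-s) := by
  have hsum : Summable fun n : ℕ => 1 / (n : ℝ) ^ s :=
    Real.summable_one_div_nat_rpow.mpr (by linarith)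
  have hsq := hasSum_zeta_two
  have hsplit := hsum.sum_add_tsum_nat_add 3
  have hsplit_sq := hsq.summable.sum_add_tsum_nat_add 3
  have htail := Summable.tsum_le_tsum (fun n => one_div_nat_add_three_rpow_le n hs)
    ((summable_nat_add_iff 3).mpr hsum)
    (((summable_nat_add_iff 3).mpr hsq.summable).mul_left _)
  rw [tsum_mul_left] at htail
  rw [hsq.tsum_eq] at hsplit_sq
  have hs0 : s ≠ 0 := by linarith
  have h2 : (1 : ℝ) / 2 ^ s = 2 ^ (-s) := by
    rw [Real.rpow_neg (by norm_num), one_div]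
  norm_num [Finset.sum_range_succ, Real.zero_rpow hs0] at hsplit hsplit_sq htail h2
  have hpi : Real.pi ^ 2 < 3.1416 ^ 2 := by
    have := Real.pi_lt_d4
    gcongr
  have hpos : (0 : ℝ) < 2 ^ (-s) := by positivity
  have hT : ∑' n : ℕ, (((n : ℝ) + 3) ^ 2)⁻¹ ≤ 3951 / 10000 := by
    norm_num at hpi
    linarith
  have := mul_le_mul_of_nonneg_left hT hpos.le
  norm_num
  linarith

theorem two_rpow_neg_le {s : ℝ} (hs : 5 / 2 ≤ s) : (2 : ℝ) ^ (-s) ≤ 177 / 1000 := by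
  calc (2 : ℝ) ^ (-s) ≤ 2 ^ (1 / 2 + (-3 : ℝ)) :=
        Real.rpow_le_rpow_of_exponent_le (by norm_num) (by linarith)
    _ = √2 / 8 := by
        rw [Real.rpow_add (by norm_num), ← Real.sqrt_eq_rpow, Real.rpow_neg (by norm_num)]
        norm_num
        ring
    _ ≤ 177 / 1000 := by
        have : √2 ≤ 1416 / 1000 := Real.sqrt_le_iff.mpr (by norm_num)
        linarith

theorem one_add_mul_pow_sub_one_lt {t : ℝ} (ht : 0 < t) (ht' : t ≤ 177 / 1000)
    {m : ℕ} (hm : 0 < m) :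
    (1 + 23 / 10 * t) ^ m - 1 < 13 / 9 * (2 ^ m * t) := by
  obtain rfl | hm_two : m = 1 ∨ 2 ≤ m := by omega
  · linarith
  · induction m, hm_two using Nat.le_induction with
    | base => nlinarith
    | succ m hm_two ih =>
      have hpow : (4 : ℝ) ≤ 2 ^ m := by
        calc (4 : ℝ) = 2 ^ 2 := by norm_num
          _ ≤ 2 ^ m := pow_le_pow_right₀ (by norm_num) hm_two
      have hprod := mul_le_mul_of_nonneg_right hpow ht.le
      have hstep := mul_lt_mul_of_pos_left (ih (by omega))
        (show 0 < 1 + 23 / 10 * t by positivity)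
      have hcoef := mul_le_mul_of_nonneg_right
        (show 1 + 23 / 10 * t ≤ 14071 / 10000 by linarith)
        (show 0 ≤ 13 / 9 * (2 ^ m * t) by positivity)
      rw [pow_succ, pow_succ]
      linarith

/-- For a positive integer `m` and real `s ≥ 5/2` one has
`ζ(s)^m - 1 < (13/9)·2^{m-s}`.  (Here `Z` is the value `ζ(s)`, which is real.) -/
theorem zeta_pow_sub_one_lt_explicit
    (m : ℕ) (hm : 0 < m) (s : ℝ) (hs : 5 / 2 ≤ s)
    (Z : ℝ) (hZ : (Z : ℂ) = riemannZeta ((s : ℝ) : ℂ)) :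
    Z ^ m - 1 < (13 / 9 : ℝ) * (2 : ℝ) ^ ((m : ℝ) - s) := by
  rw [← ofReal_tsum_one_div_nat_rpow_eq_riemannZeta (by linarith), Complex.ofReal_inj] at hZ
  have hZ0 : 0 ≤ Z := hZ ▸ tsum_nonneg fun n => by positivity
  have hZ1 : Z ≤ 1 + 23 / 10 * (2 : ℝ) ^ (-s) := hZ ▸ tsum_one_div_nat_rpow_le hs
  rw [sub_eq_add_neg (m : ℝ), Real.rpow_add (by norm_num), Real.rpow_natCast]
  have hpow := pow_le_pow_left₀ hZ0 hZ1 m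
  have := one_add_mul_pow_sub_one_lt (by positivity) (two_rpow_neg_le hs) hm
  linarith
end
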